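/- Let h : K → K be a quadratic function such that every regular elementary abelian subgroup of Aut(C_h) (i.e., every subgroup isomorphic to (Z/2)^n acting regularly on K) is conjugate in Aut(C_h) to the translation group (K,+). Then every quadratic function f : K → K that is CCZ-equivalent to h (i.e., such that σ(C_f) = C_h for some permutation σ of K) is EA-equivalent to h. -/

import Mathlib

/-- The code `C_f` associated to a function `f : K → K`. -/
def code {K : Type*} [Field K] [Algebra (ZMod 2) K] (f : K → K) : Set (K → ZMod 2) :=
  {c | ∃ (α β : K) (ε : ZMod 2),
    c = fun x => Algebra.trace (ZMod 2) K (α * x) + Algebra.trace (ZMod 2) K (β * f x) + ε}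

/-- The automorphism group of a code `C ⊆ F₂^K`, as a set of permutations of `K`. -/
def autSet {K : Type*} (C : Set (K → ZMod 2)) : Set (Equiv.Perm K) :=
  {π | (fun c : K → ZMod 2 => c ∘ ⇑π) '' C = C}

/-- The translation group `(K,+)` inside `Sym(K)`, as a set of permutations. -/
def transSet (K : Type*) [Field K] : Set (Equiv.Perm K) :=
  {π | ∃ a : K, ∀ x, π x = x + a}

/-- An affine map `K → K`. -/
def IsAffineMap {K : Type*} [Field K] [Algebra (ZMod 2) K] (A : K → K) : Prop :=
  ∃ (L : K →ₗ[ZMod 2] K) (t : K), ∀ x, A x = L x + t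

/-- EA-equivalence of functions `K → K`. -/
def EAEquiv {K : Type*} [Field K] [Algebra (ZMod 2) K] (f g : K → K) : Prop :=
  ∃ A₁ A₂ A : K → K, IsAffineMap A₁ ∧ Function.Bijective A₁ ∧
    IsAffineMap A₂ ∧ Function.Bijective A₂ ∧ IsAffineMap A ∧
    ∀ x, g x = A₁ (f (A₂ x)) + A x

open LinearMap in
/-- Two linear maps on a finite-dimensional space with the same range differ by an automorphism of
the source. -/
theorem exists_linearEquiv_comp_eq_of_range_eq {k V W : Type*} [Field k] [AddCommGroup V]
    [Module k V] [FiniteDimensional k V] [AddCommGroup W] [Module k W] (G H : V →ₗ[k] W)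
    (hr : range G = range H) : ∃ M : V ≃ₗ[k] V, ∀ v, G (M v) = H v := by
  obtain ⟨P, hP⟩ := (ker G).exists_isCompl
  obtain ⟨Q, hQ⟩ := (ker H).exists_isCompl
  have hfin : Module.finrank k (ker H) = Module.finrank k (ker G) := by
    have h1 := G.finrank_range_add_finrank_ker
    have h2 := H.finrank_range_add_finrank_ker
    rw [hr] at h1
    omega
  let e : ker H ≃ₗ[k] ker G := LinearEquiv.ofFinrankEq _ _ hfin
  let q : Q ≃ₗ[k] P :=
    (Submodule.quotientEquivOfIsCompl _ _ hQ).symm ≪≫ₗ H.quotKerEquivRange ≪≫ₗ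
      LinearEquiv.ofEq _ _ hr.symm ≪≫ₗ G.quotKerEquivRange.symm ≪≫ₗ
      Submodule.quotientEquivOfIsCompl _ _ hP
  have hq : ∀ w : Q, G (q w) = H w := by
    intro w
    have h1 : G.quotKerEquivRange ((Submodule.quotientEquivOfIsCompl _ _ hP).symm (q w)) =
        LinearEquiv.ofEq _ _ hr.symm
          (H.quotKerEquivRange ((Submodule.quotientEquivOfIsCompl _ _ hQ).symm w)) := by
      simp [q]
    simpa using congrArg Subtype.val h1
  let u := Submodule.prodEquivOfIsCompl _ _ hQ
  refine ⟨u.symm ≪≫ₗ e.prodCongr q ≪≫ₗ Submodule.prodEquivOfIsCompl _ _ hP, fun v => ?_⟩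
  obtain ⟨⟨a, b⟩, rfl⟩ := u.surjective v
  simp [u, hq]

/-- The affine functions `K → F₂`. -/
def affineFunctions (K : Type*) [Field K] : Submodule (ZMod 2) (K → ZMod 2) where
  carrier := {c | ∀ x y, c (x + y) + c 0 = c x + c y}
  add_mem' {c d} hc hd x y := by
    have h1 := hc x y
    have h2 := hd x y
    simp only [Pi.add_apply]
    linear_combination h1 + h2
  zero_mem' x y := by simp
  smul_mem' r c hc x y := by
    simp only [Pi.smul_apply, smul_eq_mul]
    linear_combination r * hc x y

theorem comp_mem_affineFunctions {K : Type*} [Field K] {ρ : K → K}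
    (hρ : ∀ x y, ρ (x + y) + ρ 0 = ρ x + ρ y) {c : K → ZMod 2} (hc : c ∈ affineFunctions K) : c ∘ ρ ∈ affineFunctions K := by
  intro x y
  have h1 := hc (ρ (x + y)) (ρ 0)
  rw [hρ, hc (ρ x) (ρ y)] at h1
  exact h1.symm

section Code

variable {K : Type*} [Field K] [Algebra (ZMod 2) K]

/-- The component functions `β ↦ Tr(β f)` of `f`. -/
noncomputable def component (f : K → K) : K →ₗ[ZMod 2] (K → ZMod 2) :=
  LinearMap.pi fun x => Algebra.trace (ZMod 2) K ∘ₗ LinearMap.mulRight (ZMod 2) (f x)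

@[simp]
theorem component_apply (f : K → K) (β x : K) :
    component f β x = Algebra.trace (ZMod 2) K (β * f x) := rfl

/-- Over `F₂`, a map that is additive up to its constant term is affine. -/
theorem isAffineMap_of_map_add {A : K → K} (hA : ∀ x y, A (x + y) + A 0 = A x + A y) :
    IsAffineMap A := by
  refine ⟨AddMonoidHom.toZModLinearMap 2
    (AddMonoidHom.mk' (fun x => A x - A 0) fun x y => ?_), A 0, fun x => ?_⟩
  · linear_combination hA x y
  · simp

variable [Finite K]

theorem eq_zero_of_trace_mul_eq_zero {x : K}
    (hx : ∀ β : K, Algebra.trace (ZMod 2) K (β * x) = 0) : x = 0 := by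
  have := Fintype.ofFinite K
  exact (traceForm_nondegenerate (ZMod 2) K).2 x hx

theorem exists_trace_eq (L : K →ₗ[ZMod 2] ZMod 2) :
    ∃ α : K, ∀ x, L x = Algebra.trace (ZMod 2) K (α * x) := by
  have := Fintype.ofFinite K
  refine ⟨((Algebra.traceForm (ZMod 2) K).toDual (traceForm_nondegenerate (ZMod 2) K)).symm L,
    fun x => ?_⟩
  rw [← Algebra.traceForm_apply]
  simp

theorem mem_code_iff {f : K → K} {c : K → ZMod 2} :
    c ∈ code f ↔ ∃ β, c - component f β ∈ affineFunctions K := by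
  constructor
  · rintro ⟨α, β, ε, rfl⟩
    refine ⟨β, fun x y => ?_⟩
    simp only [Pi.sub_apply, component_apply, mul_add, map_add, mul_zero, map_zero]
    ring
  · rintro ⟨β, hβ⟩
    set d := c - component f β with hd
    obtain ⟨α, hα⟩ := exists_trace_eq (AddMonoidHom.toZModLinearMap 2
      (AddMonoidHom.mk' (fun x => d x - d 0) fun x y => by linear_combination hβ x y))
    refine ⟨α, β, d 0, funext fun x => ?_⟩
    rw [← hα x]
    simp only [AddMonoidHom.coe_toZModLinearMap, AddMonoidHom.mk'_apply, ← component_apply, hd,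
      Pi.sub_apply]
    ring

theorem mem_code_iff_mk_mem_range {f : K → K} {c : K → ZMod 2} :
    c ∈ code f ↔ (affineFunctions K).mkQ c ∈
      LinearMap.range ((affineFunctions K).mkQ ∘ₗ component f) := by
  rw [mem_code_iff, LinearMap.mem_range]
  refine exists_congr fun β => ?_
  rw [eq_comm, LinearMap.comp_apply, Submodule.mkQ_apply, Submodule.mkQ_apply,
    Submodule.Quotient.eq]

theorem comp_mem_code_comp {f ρ : K → K} (hρ : ∀ c ∈ affineFunctions K, c ∘ ρ ∈ affineFunctions K)
    {c : K → ZMod 2} (hc : c ∈ code f) : c ∘ ρ ∈ code (f ∘ ρ) := by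
  obtain ⟨β, hβ⟩ := mem_code_iff.1 hc
  exact mem_code_iff.2 ⟨β, hρ _ hβ⟩

/-- If `ρ` is an affine permutation, then `C_{f ∘ ρ} = C_f ∘ ρ`. -/
theorem image_comp_code (f : K → K) (ρ : Equiv.Perm K)
    (hρ : ∀ x y, ρ (x + y) + ρ 0 = ρ x + ρ y) :
    (fun c : K → ZMod 2 => c ∘ ρ) '' code f = code (f ∘ ρ) := by
  have hρ' : ∀ x y, ρ.symm (x + y) + ρ.symm 0 = ρ.symm x + ρ.symm y := by
    intro x y
    apply ρ.injective
    have h1 := hρ (ρ.symm (x + y)) (ρ.symm 0)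
    have h2 := hρ (ρ.symm x) (ρ.symm y)
    simp only [Equiv.apply_symm_apply] at h1 h2
    linear_combination h1 - h2
  ext c
  constructor
  · rintro ⟨c, hc, rfl⟩
    exact comp_mem_code_comp (fun _ => comp_mem_affineFunctions hρ) hc
  · intro hc
    refine ⟨c ∘ ρ.symm, ?_, by ext x; simp⟩
    have := comp_mem_code_comp (ρ := ρ.symm) (fun _ => comp_mem_affineFunctions hρ') hc
    simpa [Function.comp_assoc] using this

/-- Functions with the same code differ by a linear permutation on the left and an affine map. -/
theorem exists_linearEquiv_of_code_eq {g h : K → K} (hgh : code g = code h) :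
    ∃ (N : K ≃ₗ[ZMod 2] K) (A : K → K), IsAffineMap A ∧ ∀ x, h x = N (g x) + A x := by
  have := Fintype.ofFinite K
  obtain ⟨M, hM⟩ := exists_linearEquiv_comp_eq_of_range_eq
    ((affineFunctions K).mkQ ∘ₗ component g) ((affineFunctions K).mkQ ∘ₗ component h) (by
      ext q
      obtain ⟨c, rfl⟩ := (affineFunctions K).mkQ_surjective q
      rw [← mem_code_iff_mk_mem_range, ← mem_code_iff_mk_mem_range, hgh])
  let B := Algebra.traceForm (ZMod 2) K
  have hB : B.Nondegenerate := traceForm_nondegenerate (ZMod 2) K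
  let N : K →ₗ[ZMod 2] K := B.leftAdjointOfNondegenerate hB M
  have hN : ∀ β y, Algebra.trace (ZMod 2) K (β * N y) = Algebra.trace (ZMod 2) K (M β * y) := by
    intro β y
    have := B.isAdjointPairLeftAdjointOfNondegenerate hB M y β
    rwa [Algebra.traceForm_apply, Algebra.traceForm_apply, mul_comm, mul_comm y] at this
  have hinj : Function.Injective N := by
    rw [injective_iff_map_eq_zero]
    intro y hy
    refine eq_zero_of_trace_mul_eq_zero fun β => ?_
    simpa [hy] using (hN (M.symm β) y).symm
  refine ⟨LinearEquiv.ofInjectiveEndo N hinj, fun x => h x - N (g x),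
    isAffineMap_of_map_add fun x y => ?_, fun x => by simp⟩
  rw [← sub_eq_zero]
  refine eq_zero_of_trace_mul_eq_zero fun β => ?_
  have h1 := (Submodule.Quotient.eq _).1 (hM β) x y
  simp only [Pi.sub_apply, component_apply, ← hN] at h1
  simp only [mul_add, mul_sub, map_sub, map_add]
  linear_combination -h1

/-- The code of a quadratic function is invariant under translations. -/
theorem comp_add_right_mem_code {f : K → K}
    (hf : ∀ a : K, IsLinearMap (ZMod 2) fun x => f (x + a) + f x + f a)
    (a : K) {c : K → ZMod 2} (hc : c ∈ code f) : (fun x => c (x + a)) ∈ code f := by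
  obtain ⟨β, hβ⟩ := mem_code_iff.1 hc
  refine mem_code_iff.2 ⟨β, fun x y => ?_⟩
  have h1 := comp_mem_affineFunctions (ρ := (· + a)) (fun x y => by ring) hβ x y
  have h2 := congrArg (fun z => Algebra.trace (ZMod 2) K (β * z)) ((hf a).map_add x y)
  have h3 := congrArg (fun z => Algebra.trace (ZMod 2) K (β * z)) (hf a).map_zero
  simp only [Function.comp_apply, Pi.sub_apply, component_apply, mul_add, map_add, mul_zero,
    map_zero] at h1 h2 h3 ⊢
  set T := Algebra.trace (ZMod 2) K
  linear_combination h1 + h2 + h3 + CharTwo.two_eq_zero (R := ZMod 2) *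
    (T (β * f x) + T (β * f y) - T (β * f (x + y)) - T (β * f 0))

end Code

/-- The conjugate by `σ⁻¹` of the translation representation of `K`. -/
def conjTranslation {K : Type*} [Field K] (σ : Equiv.Perm K) :
    Multiplicative K →* Equiv.Perm K where
  toFun a := σ⁻¹ * Equiv.addRight a.toAdd * σ
  map_one' := by ext x; simp
  map_mul' a b := by ext x; simp [add_assoc, add_comm a.toAdd]

theorem conjTranslation_apply {K : Type*} [Field K] (σ : Equiv.Perm K) (a : Multiplicative K)
    (x : K) : conjTranslation σ a x = σ.symm (σ x + a.toAdd) := rfl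

theorem conjTranslation_injective {K : Type*} [Field K] (σ : Equiv.Perm K) :
    Function.Injective (conjTranslation σ) := by
  intro a b hab
  have := congrArg (fun τ : Equiv.Perm K => σ (τ 0)) hab
  simpa [conjTranslation_apply] using this

theorem nonempty_mulEquiv_range_conjTranslation {K : Type*} [Field K] [Fintype K]
    [Algebra (ZMod 2) K] {n : ℕ} (hcard : Fintype.card K = 2 ^ n) (σ : Equiv.Perm K) :
    Nonempty ((conjTranslation σ).range ≃* Multiplicative (Fin n → ZMod 2)) := by
  have hfin : Module.finrank (ZMod 2) K = Module.finrank (ZMod 2) (Fin n → ZMod 2) := by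
    have h1 := Module.card_eq_pow_finrank (K := ZMod 2) (V := K)
    rw [hcard, ZMod.card] at h1
    simpa using (Nat.pow_right_injective le_rfl h1).symm
  exact ⟨(MonoidHom.ofInjective (conjTranslation_injective σ)).symm.trans
    (AddEquiv.toMultiplicative (LinearEquiv.ofFinrankEq _ _ hfin).toAddEquiv)⟩

/-- If `h` is quadratic and every regular elementary abelian subgroup of `Aut(C_h)`
(i.e. every subgroup isomorphic to `(Z/2)ⁿ` acting regularly on `K`, that is,
transitively with trivial point stabilizers) is conjugate in `Aut(C_h)` to the
translation group `(K,+)`, then every quadratic `f` CCZ-equivalent to `h` is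
EA-equivalent to `h`. -/
theorem stmt6 {K : Type*} [Field K] [Fintype K] [Algebra (ZMod 2) K]
    (n : ℕ) (hn : 1 ≤ n) (hcard : Fintype.card K = 2 ^ n)
    (h : K → K)
    (hquad : ∀ a : K, IsLinearMap (ZMod 2) fun x => h (x + a) + h x + h a)
    (hconj : ∀ T : Subgroup (Equiv.Perm K),
      (T : Set (Equiv.Perm K)) ⊆ autSet (code h) →
      Nonempty (T ≃* Multiplicative (Fin n → ZMod 2)) →
      (∀ x y : K, ∃ σ ∈ T, σ x = y) →
      (∀ σ ∈ T, ∀ x : K, σ x = x → σ = 1) →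
      ∃ π ∈ autSet (code h),
        (fun σ => π * σ * π⁻¹) '' transSet K = (T : Set (Equiv.Perm K)))
    (f : K → K)
    (hfquad : ∀ a : K, IsLinearMap (ZMod 2) fun x => f (x + a) + f x + f a)
    (hccz : ∃ σ : Equiv.Perm K, (fun c : K → ZMod 2 => c ∘ ⇑σ) '' code f = code h) :
    EAEquiv f h := by
  obtain ⟨σ, hσ⟩ := hccz
  have hcomp : ∀ c, c ∈ code h ↔ c ∘ σ.symm ∈ code f := by
    intro c
    rw [← hσ]
    constructor
    · rintro ⟨c, hc, rfl⟩
      simpa [Function.comp_assoc] using hc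
    · exact fun hc => ⟨_, hc, by ext x; simp⟩
  have hmem : ∀ a, ∀ c ∈ code h, c ∘ conjTranslation σ a ∈ code h := by
    intro a c hc
    rw [hcomp] at hc ⊢
    convert comp_add_right_mem_code hfquad a.toAdd hc using 1
    ext x
    simp [conjTranslation_apply]
  obtain ⟨π, hπ, hπT⟩ := hconj (conjTranslation σ).range
    (by
      rintro _ ⟨a, rfl⟩
      refine Set.Subset.antisymm ?_ fun c hc => ⟨_, hmem a⁻¹ c hc, ?_⟩
      · rintro _ ⟨c, hc, rfl⟩
        exact hmem a c hc
      · ext x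
        simp [map_inv])
    (nonempty_mulEquiv_range_conjTranslation hcard σ)
    (fun x y => ⟨_, ⟨Multiplicative.ofAdd (σ y - σ x), rfl⟩, by
      rw [conjTranslation_apply]; simp⟩)
    (by
      rintro _ ⟨a, rfl⟩ x hx
      rw [conjTranslation_apply, Equiv.symm_apply_eq, add_eq_left] at hx
      rw [show a = 1 from hx, map_one])
  let ρ : Equiv.Perm K := σ * π
  have hρ : ∀ x y, ρ (x + y) + ρ 0 = ρ x + ρ y := by
    intro x y
    obtain ⟨a, ha⟩ := hπT.subset ⟨Equiv.addRight y, ⟨y, fun _ => rfl⟩, rfl⟩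
    have key : ∀ z, ρ (z + y) = ρ z + a.toAdd := by
      intro z
      have := congrArg (fun τ : Equiv.Perm K => σ (τ (π z))) ha
      simpa [conjTranslation_apply, ρ] using this.symm
    have h0 := key 0
    rw [zero_add] at h0
    rw [key, h0]
    ring
  have hcode : code (f ∘ ρ) = code h := by
    rw [← image_comp_code f ρ hρ]
    calc (fun c : K → ZMod 2 => c ∘ ρ) '' code f
        = (fun c : K → ZMod 2 => c ∘ π) '' ((fun c : K → ZMod 2 => c ∘ σ) '' code f) := by
          rw [Set.image_image]; rfl
      _ = code h := by rw [hσ]; exact hπ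
  obtain ⟨N, A, hA, hN⟩ := exists_linearEquiv_of_code_eq hcode
  exact ⟨N, ρ, A, ⟨N, 0, fun x => by simp⟩, N.bijective, isAffineMap_of_map_add hρ, ρ.bijective,
    hA, hN⟩
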